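/- Every finitely supported function ℕ × ℤ → ℤ is a ℤ-linear combination of Betti diagrams of complete intersections; concretely, the diagrams K(j, 1, 1, …, 1) (twist j ∈ ℤ, with i entries equal to 1 for each i ∈ ℕ, where i = 0 gives the indicator function of (0, j)) span the group of finitely supported integer-valued diagrams over ℤ. -/

import Mathlib

/-- The Betti diagram of the complete intersection with determining vector
`(a0, a 0, …, a (c-1))`, as a finitely supported function `ℕ × ℤ → ℤ`:
its value at `(i, d)` counts the subsets `S ⊆ {1,…,c}` with `|S| = i`
and `a0 + Σ_{ℓ ∈ S} a ℓ = d`. -/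
noncomputable def bettiCI (c : ℕ) (a0 : ℤ) (a : Fin c → ℤ) : (ℕ × ℤ) →₀ ℤ :=
  ∑ S : Finset (Fin c), Finsupp.single (S.card, a0 + ∑ ℓ ∈ S, a ℓ) 1

theorem bettiCI_one (c : ℕ) (j : ℤ) :
    bettiCI c j (fun _ => 1) =
      ∑ S : Finset (Fin c), Finsupp.single (S.card, j + (S.card : ℤ)) 1 := by
  simp [bettiCI]

/-- Each indicator function lies in the span, by induction on the homological degree: the
full subset contributes the leading term of `K(d - i, 1, …, 1)`. -/
theorem single_mem_span_bettiCI_one (i : ℕ) (d : ℤ) :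
    Finsupp.single (i, d) (1 : ℤ) ∈ Submodule.span ℤ
      {f : (ℕ × ℤ) →₀ ℤ | ∃ (j : ℤ) (i : ℕ), f = bettiCI i j (fun _ => 1)} := by
  induction i using Nat.strong_induction_on generalizing d with
  | _ i ih =>
    have h := bettiCI_one i (d - i)
    rw [← Finset.add_sum_erase _ _ (Finset.mem_univ (Finset.univ : Finset (Fin i)))] at h
    simp only [Finset.card_univ, Fintype.card_fin, sub_add_cancel] at h
    rw [← sub_eq_iff_eq_add] at h
    rw [← h]
    refine Submodule.sub_mem _ (Submodule.subset_span ⟨d - i, i, rfl⟩)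
      (Submodule.sum_mem _ fun S hS => ih _ ?_ _)
    simpa using Finset.card_lt_card
      (Finset.ssubset_univ_iff.mpr (Finset.ne_of_mem_erase hS))

/-- The diagrams `K(j, 1, …, 1)` (twist `j ∈ ℤ`, with `i` entries equal to `1`;
for `i = 0` this is the indicator function of `(0, j)`) span the group of all
finitely supported integer-valued diagrams over `ℤ`. -/
theorem stmt12 :
    Submodule.span ℤ
        {f : (ℕ × ℤ) →₀ ℤ | ∃ (j : ℤ) (i : ℕ), f = bettiCI i j (fun _ => 1)} =
      ⊤ := by
  refine eq_top_iff.mpr fun f _ => ?_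
  rw [← f.sum_single]
  refine Submodule.sum_mem _ fun p _ => ?_
  rw [← mul_one (f p), ← smul_eq_mul, ← Finsupp.smul_single]
  exact Submodule.smul_mem _ _ (single_mem_span_bettiCI_one p.1 p.2)
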